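/- Let F be a field of characteristic ≠ 2 with pairwise distinct elements ζ₁,...,ζ₆, and let Λ be the exterior algebra on generators a_t, b_t for each 4-element subset t of {1,...,6}. Define the 4-simplex weights W_{ijklm} := (1/ζ_{lm})·v_{ijklm,1}∧v_{ijklm,2}∧v_{ijklm,3} via the substitution 1↦i,...,5↦m in the explicit formulas for v_{12345,1}, v_{12345,2}, v_{12345,3}. Let d₁₂₃ := Σ_{t ⊃ {1,2,3}} d_{t,{1,2,3}} be the Grassmann differential operator of the paper acting by odd derivations ∂/∂a_t, ∂/∂b_t, and let w₁₂₃ := ζ₂₃⁻¹ ζ₃₄ a₁₂₃₄, w₄₅₆ := −b₁₄₅₆. Then the Berezin integral identity holds: ∫ W₁₂₃₄₅ W₁₂₃₄₆ W₁₂₃₅₆ w₁₂₃ (da₁₂₃₄ db₁₂₃₄/ζ₃₄)(da₁₂₃₅ db₁₂₃₅/ζ₃₅)(da₁₂₃₆ db₁₂₃₆/ζ₃₆) = ∫ W₁₂₄₅₆ W₁₃₄₅₆ W₂₃₄₅₆ w₄₅₆ (da₁₄₅₆ db₁₄₅₆/ζ₅₆)(da₂₄₅₆ db₂₄₅₆/ζ₅₆)(da₃₄₅₆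 db₃₄₅₆/ζ₅₆). -/

import Mathlib

set_option linter.unusedSimpArgs false

noncomputable section

variable (F : Type*) [Field F]

/-- Exterior (Grassmann) algebra on generators `a_t, b_t` indexed by 4-element subsets
(tetrahedra) `t ⊂ {1,…,6}` (vertices 0-indexed as `Fin 6`). -/
abbrev Lam := ExteriorAlgebra F ((Bool × Finset (Fin 6)) → F)

/-- generator `a_t` -/
def av (t : Finset (Fin 6)) : Lam F := ExteriorAlgebra.ι F (Pi.single (false, t) 1)
/-- generator `b_t` -/
def bv (t : Finset (Fin 6)) : Lam F := ExteriorAlgebra.ι F (Pi.single (true, t) 1)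

/-- The odd derivation `∂/∂a_t` (left contraction with the dual of `a_t`). -/
def da (t : Finset (Fin 6)) : Lam F →ₗ[F] Lam F :=
  CliffordAlgebra.contractLeft (LinearMap.proj (false, t))
/-- The odd derivation `∂/∂b_t`. -/
def db (t : Finset (Fin 6)) : Lam F →ₗ[F] Lam F :=
  CliffordAlgebra.contractLeft (LinearMap.proj (true, t))

/-- Berezin integral `∫ f da_t db_t`: iterated left-coefficient extraction,
`∫ f da` being the coefficient of `a` in the expansion of `f` in `a`. -/
def int2 (t : Finset (Fin 6)) (f : Lam F) : Lam F := db F t (da F t f)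

variable (ζ : Fin 6 → F)

/-- `v_{ijklm,1}` for the 4-simplex with vertices `i<j<k<l<m`. -/
def v1 (i j k l m : Fin 6) : Lam F :=
  (ζ k - ζ l) • av F {i,j,k,l} - (ζ k - ζ m) • av F {i,j,k,m}
    + (ζ l - ζ m) • av F {i,j,l,m} - (ζ l - ζ m) • av F {i,k,l,m}

/-- `v_{ijklm,2}`. -/
def v2 (i j k l m : Fin 6) : Lam F :=
  (ζ k - ζ l) • bv F {i,j,k,l} - (ζ k - ζ m) • bv F {i,j,k,m}
    + (ζ l - ζ m) • bv F {i,j,l,m} + (ζ l - ζ m) • av F {j,k,l,m}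

/-- `v_{ijklm,3}`. -/
def v3 (i j k l m : Fin 6) : Lam F :=
  -((ζ i - ζ l) • av F {i,j,k,l}) - (ζ j - ζ l) • bv F {i,j,k,l}
    + (ζ i - ζ m) • av F {i,j,k,m} + (ζ j - ζ m) • bv F {i,j,k,m}
    - (ζ l - ζ m) • bv F {i,k,l,m} + (ζ l - ζ m) • bv F {j,k,l,m}

/-- The undeformed Grassmann weight `W_{ijklm} = (1/ζ_{lm}) v₁v₂v₃` of a 4-simplex. -/
def W (i j k l m : Fin 6) : Lam F :=
  (ζ l - ζ m)⁻¹ • (v1 F ζ i j k l m * v2 F ζ i j k l m * v3 F ζ i j k l m)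

abbrev VM := (Bool × Finset (Fin 6)) → F
abbrev ea (t : Finset (Fin 6)) : VM F := Pi.single (false, t) 1
abbrev eb (t : Finset (Fin 6)) : VM F := Pi.single (true, t) 1

def l1 (i j k l m : Fin 6) : VM F :=
  (ζ k - ζ l) • ea F {i,j,k,l} - (ζ k - ζ m) • ea F {i,j,k,m}
    + (ζ l - ζ m) • ea F {i,j,l,m} - (ζ l - ζ m) • ea F {i,k,l,m}

def l2 (i j k l m : Fin 6) : VM F :=
  (ζ k - ζ l) • eb F {i,j,k,l} - (ζ k - ζ m) • eb F {i,j,k,m}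
    + (ζ l - ζ m) • eb F {i,j,l,m} + (ζ l - ζ m) • ea F {j,k,l,m}

def l3 (i j k l m : Fin 6) : VM F :=
  -((ζ i - ζ l) • ea F {i,j,k,l}) - (ζ j - ζ l) • eb F {i,j,k,l}
    + (ζ i - ζ m) • ea F {i,j,k,m} + (ζ j - ζ m) • eb F {i,j,k,m}
    - (ζ l - ζ m) • eb F {i,k,l,m} + (ζ l - ζ m) • eb F {j,k,l,m}

theorem v1_eq (i j k l m : Fin 6) : v1 F ζ i j k l m = ExteriorAlgebra.ι F (l1 F ζ i j k l m) := by
  simp only [v1, l1, av, map_add, map_sub, map_smul]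
theorem v2_eq (i j k l m : Fin 6) : v2 F ζ i j k l m = ExteriorAlgebra.ι F (l2 F ζ i j k l m) := by
  simp only [v2, l2, av, bv, map_add, map_sub, map_smul]
theorem v3_eq (i j k l m : Fin 6) : v3 F ζ i j k l m = ExteriorAlgebra.ι F (l3 F ζ i j k l m) := by
  simp only [v3, l3, av, bv, map_add, map_sub, map_smul, map_neg]

theorem row_step {F : Type*} [Field F] {M N : Type*} [AddCommGroup M] [Module F M]
    [AddCommGroup N] [Module F N] {n : ℕ} (f : M [⋀^Fin n]→ₗ[F] N) (x y : Fin n → M) (i : Fin n)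
    (co : Fin n → F) (h1 : ∀ j, j ≠ i → y j = x j) (h2 : y i = ∑ j, co j • x j) :
    f y = co i • f x := by
  have hy : y = Function.update x i (∑ j, co j • x j) := by
    funext j
    by_cases hj : j = i
    · subst hj; simp [h2]
    · simp [hj, h1 j hj]
  rw [hy, AlternatingMap.map_update_sum, Finset.sum_eq_single i]
  · rw [AlternatingMap.map_update_smul, Function.update_eq_self]
  · intro j _ hj
    rw [AlternatingMap.map_update_smul, AlternatingMap.map_update_self _ _ (Ne.symm hj), smul_zero]
  · simp

/-- Product of ten vectors. -/
def P10 (r0 r1 r2 r3 r4 r5 r6 r7 r8 r9 : VM F) : Lam F :=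
  ExteriorAlgebra.ιMulti F 10 ![r0, r1, r2, r3, r4, r5, r6, r7, r8, r9]

theorem P10_eq (r0 r1 r2 r3 r4 r5 r6 r7 r8 r9 : VM F) :
    P10 F r0 r1 r2 r3 r4 r5 r6 r7 r8 r9 =
      ExteriorAlgebra.ι F r0 * (ExteriorAlgebra.ι F r1 * (ExteriorAlgebra.ι F r2 *
      (ExteriorAlgebra.ι F r3 * (ExteriorAlgebra.ι F r4 * (ExteriorAlgebra.ι F r5 *
      (ExteriorAlgebra.ι F r6 * (ExteriorAlgebra.ι F r7 * (ExteriorAlgebra.ι F r8 *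
      ExteriorAlgebra.ι F r9)))))))) := by
  simp [P10, ExteriorAlgebra.ιMulti_apply]

theorem da_mul (t : Finset (Fin 6)) (x : VM F) (Y : Lam F) :
    da F t (ExteriorAlgebra.ι F x * Y) = x (false, t) • Y - ExteriorAlgebra.ι F x * da F t Y :=
  CliffordAlgebra.contractLeft_ι_mul _ _ _
theorem db_mul (t : Finset (Fin 6)) (x : VM F) (Y : Lam F) :
    db F t (ExteriorAlgebra.ι F x * Y) = x (true, t) • Y - ExteriorAlgebra.ι F x * db F t Y :=
  CliffordAlgebra.contractLeft_ι_mul _ _ _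
theorem da_one (t : Finset (Fin 6)) (x : VM F) :
    da F t (ExteriorAlgebra.ι F x) = algebraMap F (Lam F) (x (false, t)) :=
  CliffordAlgebra.contractLeft_ι _ _ _
theorem db_one (t : Finset (Fin 6)) (x : VM F) :
    db F t (ExteriorAlgebra.ι F x) = algebraMap F (Lam F) (x (true, t)) :=
  CliffordAlgebra.contractLeft_ι _ _ _

def U1 : VM F := l1 F ζ 0 1 3 4 5 - l1 F ζ 0 2 3 4 5
def U2 : VM F := l2 F ζ 0 1 3 4 5 + l1 F ζ 1 2 3 4 5
def U3 : VM F := l2 F ζ 1 2 3 4 5 - l2 F ζ 0 2 3 4 5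
def U4 : VM F := l3 F ζ 0 1 3 4 5 - l3 F ζ 0 2 3 4 5 + l3 F ζ 1 2 3 4 5

theorem u1_eq : U1 F ζ = l1 F ζ 0 1 2 3 4 - l1 F ζ 0 1 2 3 5 + l1 F ζ 0 1 2 4 5 := by
  simp only [U1, l1]; module
theorem u2_eq : U2 F ζ = l2 F ζ 0 1 2 3 4 - l2 F ζ 0 1 2 3 5 + l2 F ζ 0 1 2 4 5 := by
  simp only [U2, l1, l2]; module
theorem u3_eq : U3 F ζ = l3 F ζ 0 1 2 3 4 - l3 F ζ 0 1 2 3 5 + l3 F ζ 0 1 2 4 5 := by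
  simp only [U3, l2, l3]; module
theorem lhs_red {F : Type*} [Field F] {M N : Type*} [AddCommGroup M] [Module F M]
    [AddCommGroup N] [Module F N] (f : M [⋀^Fin 10]→ₗ[F] N) (p1 p2 p3 q1 q2 q3 r1 r2 r3 w U1 U2 U3 U4 X Y S T V : M) (c1 c2 c3 c4 c5 c6 c7 c8 c9 c10 c11 k : F)
    (hr1 : r1 = U1 - p1 + q1)
    (hr2 : r2 = U2 - p2 + q2)
    (hr3 : r3 = U3 - p3 + q3)
    (hp1 : p1 = X + c1 • w)
    (hq1 : q1 = Y + c2 • w)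
    (hp3 : p3 = S + c3 • w + c4 • X + c5 • p2)
    (hq3 : q3 = k • U4 + c6 • S + c7 • w + c8 • Y + c9 • q2)
    (hp2 : p2 = T + c10 • S)
    (hq2 : q2 = V + c11 • S) :
    f ![p1, p2, p3, q1, q2, q3, r1, r2, r3, w] = k • f ![X, T, S, Y, V, U4, U1, U2, U3, w] := by
  have s0 : f ![p1, p2, p3, q1, q2, q3, r1, r2, r3, w] = (1 : F) • f ![p1, p2, p3, q1, q2, q3, U1, r2, r3, w] := by
    refine row_step f _ _ 6 ![-1, 0, 0, 1, 0, 0, 1, 0, 0, 0] ?_ ?_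
    · simp [Fin.forall_fin_succ]
    · simp [Fin.sum_univ_succ]
      linear_combination (norm := module) hr1
  have s1 : f ![p1, p2, p3, q1, q2, q3, U1, r2, r3, w] = (1 : F) • f ![p1, p2, p3, q1, q2, q3, U1, U2, r3, w] := by
    refine row_step f _ _ 7 ![0, -1, 0, 0, 1, 0, 0, 1, 0, 0] ?_ ?_
    · simp [Fin.forall_fin_succ]
    · simp [Fin.sum_univ_succ]
      linear_combination (norm := module) hr2
  have s2 : f ![p1, p2, p3, q1, q2, q3, U1, U2, r3, w] = (1 : F) • f ![p1, p2, p3, q1, q2, q3, U1, U2, U3, w] := by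
    refine row_step f _ _ 8 ![0, 0, -1, 0, 0, 1, 0, 0, 1, 0] ?_ ?_
    · simp [Fin.forall_fin_succ]
    · simp [Fin.sum_univ_succ]
      linear_combination (norm := module) hr3
  have s3 : f ![p1, p2, p3, q1, q2, q3, U1, U2, U3, w] = (1 : F) • f ![X, p2, p3, q1, q2, q3, U1, U2, U3, w] := by
    refine row_step f _ _ 0 ![1, 0, 0, 0, 0, 0, 0, 0, 0, c1] ?_ ?_
    · simp [Fin.forall_fin_succ]
    · simp [Fin.sum_univ_succ]
      linear_combination (norm := module) hp1
  have s4 : f ![X, p2, p3, q1, q2, q3, U1, U2, U3, w] = (1 : F) • f ![X, p2, p3, Y, q2, q3, U1, U2, U3, w] := by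
    refine row_step f _ _ 3 ![0, 0, 0, 1, 0, 0, 0, 0, 0, c2] ?_ ?_
    · simp [Fin.forall_fin_succ]
    · simp [Fin.sum_univ_succ]
      linear_combination (norm := module) hq1
  have s5 : f ![X, p2, p3, Y, q2, q3, U1, U2, U3, w] = (1 : F) • f ![X, p2, S, Y, q2, q3, U1, U2, U3, w] := by
    refine row_step f _ _ 2 ![c4, c5, 1, 0, 0, 0, 0, 0, 0, c3] ?_ ?_
    · simp [Fin.forall_fin_succ]
    · simp [Fin.sum_univ_succ]
      linear_combination (norm := module) hp3
  have s6 : f ![X, p2, S, Y, q2, q3, U1, U2, U3, w] = (k : F) • f ![X, p2, S, Y, q2, U4, U1, U2, U3, w] := by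
    refine row_step f _ _ 5 ![0, 0, c6, c8, c9, k, 0, 0, 0, c7] ?_ ?_
    · simp [Fin.forall_fin_succ]
    · simp [Fin.sum_univ_succ]
      linear_combination (norm := module) hq3
  have s7 : f ![X, p2, S, Y, q2, U4, U1, U2, U3, w] = (1 : F) • f ![X, T, S, Y, q2, U4, U1, U2, U3, w] := by
    refine row_step f _ _ 1 ![0, 1, c10, 0, 0, 0, 0, 0, 0, 0] ?_ ?_
    · simp [Fin.forall_fin_succ]
    · simp [Fin.sum_univ_succ]
      linear_combination (norm := module) hp2
  have s8 : f ![X, T, S, Y, q2, U4, U1, U2, U3, w] = (1 : F) • f ![X, T, S, Y, V, U4, U1, U2, U3, w] := by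
    refine row_step f _ _ 4 ![0, 0, c11, 0, 1, 0, 0, 0, 0, 0] ?_ ?_
    · simp [Fin.forall_fin_succ]
    · simp [Fin.sum_univ_succ]
      linear_combination (norm := module) hq2
  rw [s0, s1, s2, s3, s4, s5, s6, s7, s8]
  simp only [smul_smul, one_mul, mul_one, one_smul]

theorem rhs_red {F : Type*} [Field F] {M N : Type*} [AddCommGroup M] [Module F M]
    [AddCommGroup N] [Module F N] (f : M [⋀^Fin 10]→ₗ[F] N) (p1 p2 p3 q1 q2 q3 r1 r2 r3 w U1 U2 U3 U4 Q R : M) (c : F)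
    (hp1 : p1 = U1 + q1)
    (hp2 : p2 = U2 - r1)
    (hq2 : q2 = r2 - U3)
    (hr3 : r3 = U4 - p3 + q3)
    (hp3 : p3 = Q + c • w)
    (hq3 : q3 = R + c • w) :
    f ![p1, p2, p3, q1, q2, q3, r1, r2, r3, w] = (-1 : F) • f ![U1, U2, Q, q1, U3, R, r1, r2, U4, w] := by
  have s0 : f ![p1, p2, p3, q1, q2, q3, r1, r2, r3, w] = (1 : F) • f ![U1, p2, p3, q1, q2, q3, r1, r2, r3, w] := by
    refine row_step f _ _ 0 ![1, 0, 0, 1, 0, 0, 0, 0, 0, 0] ?_ ?_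
    · simp [Fin.forall_fin_succ]
    · simp [Fin.sum_univ_succ]
      linear_combination (norm := module) hp1
  have s1 : f ![U1, p2, p3, q1, q2, q3, r1, r2, r3, w] = (1 : F) • f ![U1, U2, p3, q1, q2, q3, r1, r2, r3, w] := by
    refine row_step f _ _ 1 ![0, 1, 0, 0, 0, 0, -1, 0, 0, 0] ?_ ?_
    · simp [Fin.forall_fin_succ]
    · simp [Fin.sum_univ_succ]
      linear_combination (norm := module) hp2
  have s2 : f ![U1, U2, p3, q1, q2, q3, r1, r2, r3, w] = (-1 : F) • f ![U1, U2, p3, q1, U3, q3, r1, r2, r3, w] := by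
    refine row_step f _ _ 4 ![0, 0, 0, 0, -1, 0, 0, 1, 0, 0] ?_ ?_
    · simp [Fin.forall_fin_succ]
    · simp [Fin.sum_univ_succ]
      linear_combination (norm := module) hq2
  have s3 : f ![U1, U2, p3, q1, U3, q3, r1, r2, r3, w] = (1 : F) • f ![U1, U2, p3, q1, U3, q3, r1, r2, U4, w] := by
    refine row_step f _ _ 8 ![0, 0, -1, 0, 0, 1, 0, 0, 1, 0] ?_ ?_
    · simp [Fin.forall_fin_succ]
    · simp [Fin.sum_univ_succ]
      linear_combination (norm := module) hr3
  have s4 : f ![U1, U2, p3, q1, U3, q3, r1, r2, U4, w] = (1 : F) • f ![U1, U2, Q, q1, U3, q3, r1, r2, U4, w] := by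
    refine row_step f _ _ 2 ![0, 0, 1, 0, 0, 0, 0, 0, 0, c] ?_ ?_
    · simp [Fin.forall_fin_succ]
    · simp [Fin.sum_univ_succ]
      linear_combination (norm := module) hp3
  have s5 : f ![U1, U2, Q, q1, U3, q3, r1, r2, U4, w] = (1 : F) • f ![U1, U2, Q, q1, U3, R, r1, r2, U4, w] := by
    refine row_step f _ _ 5 ![0, 0, 0, 0, 0, 1, 0, 0, 0, c] ?_ ?_
    · simp [Fin.forall_fin_succ]
    · simp [Fin.sum_univ_succ]
      linear_combination (norm := module) hq3
  rw [s0, s1, s2, s3, s4, s5]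
  simp only [smul_smul, one_mul, mul_one, one_smul]

theorem U1_L : (U1 F ζ) (false, {0,1,2,3}) = 0 ∧
    (U1 F ζ) (true, {0,1,2,3}) = 0 ∧
    (U1 F ζ) (false, {0,1,2,4}) = 0 ∧
    (U1 F ζ) (true, {0,1,2,4}) = 0 ∧
    (U1 F ζ) (false, {0,1,2,5}) = 0 ∧
    (U1 F ζ) (true, {0,1,2,5}) = 0 := by
  simp (decide := true) [U1, l1, l2, l3]

theorem U1_R : (U1 F ζ) (false, {0,3,4,5}) = 0 ∧
    (U1 F ζ) (true, {0,3,4,5}) = 0 ∧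
    (U1 F ζ) (false, {1,3,4,5}) = 0 ∧
    (U1 F ζ) (true, {1,3,4,5}) = 0 ∧
    (U1 F ζ) (false, {2,3,4,5}) = 0 ∧
    (U1 F ζ) (true, {2,3,4,5}) = 0 := by
  simp (decide := true) [U1, l1, l2, l3]

theorem U2_L : (U2 F ζ) (false, {0,1,2,3}) = 0 ∧
    (U2 F ζ) (true, {0,1,2,3}) = 0 ∧
    (U2 F ζ) (false, {0,1,2,4}) = 0 ∧
    (U2 F ζ) (true, {0,1,2,4}) = 0 ∧
    (U2 F ζ) (false, {0,1,2,5}) = 0 ∧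
    (U2 F ζ) (true, {0,1,2,5}) = 0 := by
  simp (decide := true) [U2, l1, l2, l3]

theorem U2_R : (U2 F ζ) (false, {0,3,4,5}) = 0 ∧
    (U2 F ζ) (true, {0,3,4,5}) = 0 ∧
    (U2 F ζ) (false, {1,3,4,5}) = 0 ∧
    (U2 F ζ) (true, {1,3,4,5}) = 0 ∧
    (U2 F ζ) (false, {2,3,4,5}) = 0 ∧
    (U2 F ζ) (true, {2,3,4,5}) = 0 := by
  simp (decide := true) [U2, l1, l2, l3]

theorem U3_L : (U3 F ζ) (false, {0,1,2,3}) = 0 ∧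
    (U3 F ζ) (true, {0,1,2,3}) = 0 ∧
    (U3 F ζ) (false, {0,1,2,4}) = 0 ∧
    (U3 F ζ) (true, {0,1,2,4}) = 0 ∧
    (U3 F ζ) (false, {0,1,2,5}) = 0 ∧
    (U3 F ζ) (true, {0,1,2,5}) = 0 := by
  simp (decide := true) [U3, l1, l2, l3]

theorem U3_R : (U3 F ζ) (false, {0,3,4,5}) = 0 ∧
    (U3 F ζ) (true, {0,3,4,5}) = 0 ∧
    (U3 F ζ) (false, {1,3,4,5}) = 0 ∧
    (U3 F ζ) (true, {1,3,4,5}) = 0 ∧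
    (U3 F ζ) (false, {2,3,4,5}) = 0 ∧
    (U3 F ζ) (true, {2,3,4,5}) = 0 := by
  simp (decide := true) [U3, l1, l2, l3]

theorem U4_L : (U4 F ζ) (false, {0,1,2,3}) = 0 ∧
    (U4 F ζ) (true, {0,1,2,3}) = 0 ∧
    (U4 F ζ) (false, {0,1,2,4}) = 0 ∧
    (U4 F ζ) (true, {0,1,2,4}) = 0 ∧
    (U4 F ζ) (false, {0,1,2,5}) = 0 ∧
    (U4 F ζ) (true, {0,1,2,5}) = 0 := by
  simp (decide := true) [U4, l1, l2, l3]

theorem U4_R : (U4 F ζ) (false, {0,3,4,5}) = 0 ∧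
    (U4 F ζ) (true, {0,3,4,5}) = 0 ∧
    (U4 F ζ) (false, {1,3,4,5}) = 0 ∧
    (U4 F ζ) (true, {1,3,4,5}) = 0 ∧
    (U4 F ζ) (false, {2,3,4,5}) = 0 ∧
    (U4 F ζ) (true, {2,3,4,5}) = 0 := by
  simp (decide := true) [U4, l1, l2, l3]


def LX : VM F := l1 F ζ 0 1 2 3 4 - (ζ 2 - ζ 3) • ea F {0,1,2,3}
def LY : VM F := l1 F ζ 0 1 2 3 5 - (ζ 2 - ζ 3) • ea F {0,1,2,3}
def LS : VM F := l3 F ζ 0 1 2 3 4 + (ζ 0 - ζ 3) • ea F {0,1,2,3}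
  + ((ζ 0 - ζ 4) / (ζ 2 - ζ 4)) • LX F ζ + ((ζ 1 - ζ 4) / (ζ 2 - ζ 4)) • l2 F ζ 0 1 2 3 4
def LTT : VM F := l2 F ζ 0 1 2 3 4 +
  ((ζ 2 - ζ 3) * (ζ 2 - ζ 4) / ((ζ 1 - ζ 2) * (ζ 3 - ζ 4))) • LS F ζ
def LV : VM F := l2 F ζ 0 1 2 3 5 +
  ((ζ 2 - ζ 3) * (ζ 2 - ζ 4) / ((ζ 1 - ζ 2) * (ζ 3 - ζ 4))) • LS F ζ
def RQ : VM F := l3 F ζ 0 1 3 4 5 + (ζ 4 - ζ 5) • eb F {0,3,4,5}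
def RR : VM F := l3 F ζ 0 2 3 4 5 + (ζ 4 - ζ 5) • eb F {0,3,4,5}

theorem LX_L  : (LX F ζ) (false, {0,1,2,3}) = 0 ∧
    (LX F ζ) (true, {0,1,2,3}) = 0 ∧
    (LX F ζ) (false, {0,1,2,4}) = -(ζ 2 - ζ 4) ∧
    (LX F ζ) (true, {0,1,2,4}) = 0 ∧
    (LX F ζ) (false, {0,1,2,5}) = 0 ∧
    (LX F ζ) (true, {0,1,2,5}) = 0 := by
  simp (decide := true) [LX, l1]

theorem LY_L  : (LY F ζ) (false, {0,1,2,3}) = 0 ∧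
    (LY F ζ) (true, {0,1,2,3}) = 0 ∧
    (LY F ζ) (false, {0,1,2,4}) = 0 ∧
    (LY F ζ) (true, {0,1,2,4}) = 0 ∧
    (LY F ζ) (false, {0,1,2,5}) = -(ζ 2 - ζ 5) ∧
    (LY F ζ) (true, {0,1,2,5}) = 0 := by
  simp (decide := true) [LY, l1]

theorem W_L  : (ea F {0,1,2,3}) (false, {0,1,2,3}) = 1 ∧
    (ea F {0,1,2,3}) (true, {0,1,2,3}) = 0 ∧
    (ea F {0,1,2,3}) (false, {0,1,2,4}) = 0 ∧
    (ea F {0,1,2,3}) (true, {0,1,2,4}) = 0 ∧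
    (ea F {0,1,2,3}) (false, {0,1,2,5}) = 0 ∧
    (ea F {0,1,2,3}) (true, {0,1,2,5}) = 0 := by
  simp (decide := true) []

theorem LS_L (h24 : (ζ 2 - ζ 4) ≠ 0) : (LS F ζ) (false, {0,1,2,3}) = 0 ∧
    (LS F ζ) (true, {0,1,2,3}) = -((ζ 1 - ζ 2) * (ζ 3 - ζ 4) / (ζ 2 - ζ 4)) ∧
    (LS F ζ) (false, {0,1,2,4}) = 0 ∧
    (LS F ζ) (true, {0,1,2,4}) = 0 ∧
    (LS F ζ) (false, {0,1,2,5}) = 0 ∧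
    (LS F ζ) (true, {0,1,2,5}) = 0 := by
  have h := LX_L F ζ
  refine ⟨?_, ?_, ?_, ?_, ?_, ?_⟩ <;> simp (decide := true) [LS, l3, l2, h] <;> field_simp <;> ring

theorem LTT_L (h24 : (ζ 2 - ζ 4) ≠ 0) (h12 : (ζ 1 - ζ 2) ≠ 0) (h34 : (ζ 3 - ζ 4) ≠ 0) : (LTT F ζ) (false, {0,1,2,3}) = 0 ∧
    (LTT F ζ) (true, {0,1,2,3}) = 0 ∧
    (LTT F ζ) (false, {0,1,2,4}) = 0 ∧
    (LTT F ζ) (true, {0,1,2,4}) = -(ζ 2 - ζ 4) ∧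
    (LTT F ζ) (false, {0,1,2,5}) = 0 ∧
    (LTT F ζ) (true, {0,1,2,5}) = 0 := by
  have h := LS_L F ζ h24
  refine ⟨?_, ?_, ?_, ?_, ?_, ?_⟩ <;> simp (decide := true) [LTT, l2, h] <;> field_simp <;> ring

theorem LV_L (h24 : (ζ 2 - ζ 4) ≠ 0) (h12 : (ζ 1 - ζ 2) ≠ 0) (h34 : (ζ 3 - ζ 4) ≠ 0) : (LV F ζ) (false, {0,1,2,3}) = 0 ∧
    (LV F ζ) (true, {0,1,2,3}) = 0 ∧
    (LV F ζ) (false, {0,1,2,4}) = 0 ∧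
    (LV F ζ) (true, {0,1,2,4}) = 0 ∧
    (LV F ζ) (false, {0,1,2,5}) = 0 ∧
    (LV F ζ) (true, {0,1,2,5}) = -(ζ 2 - ζ 5) := by
  have h := LS_L F ζ h24
  refine ⟨?_, ?_, ?_, ?_, ?_, ?_⟩ <;> simp (decide := true) [LV, l2, h] <;> field_simp <;> ring

theorem W_R  : (eb F {0,3,4,5}) (false, {0,3,4,5}) = 0 ∧
    (eb F {0,3,4,5}) (true, {0,3,4,5}) = 1 ∧
    (eb F {0,3,4,5}) (false, {1,3,4,5}) = 0 ∧
    (eb F {0,3,4,5}) (true, {1,3,4,5}) = 0 ∧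
    (eb F {0,3,4,5}) (false, {2,3,4,5}) = 0 ∧
    (eb F {0,3,4,5}) (true, {2,3,4,5}) = 0 := by
  simp (decide := true) []

theorem RQ_R  : (RQ F ζ) (false, {0,3,4,5}) = 0 ∧
    (RQ F ζ) (true, {0,3,4,5}) = 0 ∧
    (RQ F ζ) (false, {1,3,4,5}) = 0 ∧
    (RQ F ζ) (true, {1,3,4,5}) = (ζ 4 - ζ 5) ∧
    (RQ F ζ) (false, {2,3,4,5}) = 0 ∧
    (RQ F ζ) (true, {2,3,4,5}) = 0 := by
  simp (decide := true) [RQ, l3]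

theorem RR_R  : (RR F ζ) (false, {0,3,4,5}) = 0 ∧
    (RR F ζ) (true, {0,3,4,5}) = 0 ∧
    (RR F ζ) (false, {1,3,4,5}) = 0 ∧
    (RR F ζ) (true, {1,3,4,5}) = 0 ∧
    (RR F ζ) (false, {2,3,4,5}) = 0 ∧
    (RR F ζ) (true, {2,3,4,5}) = (ζ 4 - ζ 5) := by
  simp (decide := true) [RR, l3]

theorem q1_R  : (l1 F ζ 0 2 3 4 5) (false, {0,3,4,5}) = -(ζ 4 - ζ 5) ∧
    (l1 F ζ 0 2 3 4 5) (true, {0,3,4,5}) = 0 ∧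
    (l1 F ζ 0 2 3 4 5) (false, {1,3,4,5}) = 0 ∧
    (l1 F ζ 0 2 3 4 5) (true, {1,3,4,5}) = 0 ∧
    (l1 F ζ 0 2 3 4 5) (false, {2,3,4,5}) = 0 ∧
    (l1 F ζ 0 2 3 4 5) (true, {2,3,4,5}) = 0 := by
  simp (decide := true) [l1]

theorem r1_R  : (l1 F ζ 1 2 3 4 5) (false, {0,3,4,5}) = 0 ∧
    (l1 F ζ 1 2 3 4 5) (true, {0,3,4,5}) = 0 ∧
    (l1 F ζ 1 2 3 4 5) (false, {1,3,4,5}) = -(ζ 4 - ζ 5) ∧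
    (l1 F ζ 1 2 3 4 5) (true, {1,3,4,5}) = 0 ∧
    (l1 F ζ 1 2 3 4 5) (false, {2,3,4,5}) = 0 ∧
    (l1 F ζ 1 2 3 4 5) (true, {2,3,4,5}) = 0 := by
  simp (decide := true) [l1]

theorem r2_R  : (l2 F ζ 1 2 3 4 5) (false, {0,3,4,5}) = 0 ∧
    (l2 F ζ 1 2 3 4 5) (true, {0,3,4,5}) = 0 ∧
    (l2 F ζ 1 2 3 4 5) (false, {1,3,4,5}) = 0 ∧
    (l2 F ζ 1 2 3 4 5) (true, {1,3,4,5}) = 0 ∧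
    (l2 F ζ 1 2 3 4 5) (false, {2,3,4,5}) = (ζ 4 - ζ 5) ∧
    (l2 F ζ 1 2 3 4 5) (true, {2,3,4,5}) = 0 := by
  simp (decide := true) [l2]


def PU : Lam F := ExteriorAlgebra.ι F (U1 F ζ) * (ExteriorAlgebra.ι F (U2 F ζ) *
  (ExteriorAlgebra.ι F (U3 F ζ) * ExteriorAlgebra.ι F (U4 F ζ)))

theorem swap_aux (x y : VM F) (Z : Lam F) : ExteriorAlgebra.ι F x * (ExteriorAlgebra.ι F y * Z) =
    -(ExteriorAlgebra.ι F y * (ExteriorAlgebra.ι F x * Z)) := by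
  have h := ExteriorAlgebra.ι_add_mul_swap (R := F) x y
  rw [← mul_assoc, ← mul_assoc, ← neg_mul, eq_neg_of_add_eq_zero_left h]

theorem PU_rot : ExteriorAlgebra.ι F (U4 F ζ) * (ExteriorAlgebra.ι F (U1 F ζ) *
    (ExteriorAlgebra.ι F (U2 F ζ) * ExteriorAlgebra.ι F (U3 F ζ))) = - PU F ζ := by
  have h := ExteriorAlgebra.ι_add_mul_swap (R := F) (U4 F ζ) (U3 F ζ)
  rw [swap_aux, swap_aux F (U4 F ζ), eq_neg_of_add_eq_zero_left h, PU]
  simp only [mul_neg, neg_neg]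

theorem int_L (h24 : (ζ 2 - ζ 4) ≠ 0) (h12 : (ζ 1 - ζ 2) ≠ 0) (h34 : (ζ 3 - ζ 4) ≠ 0) :
    int2 F {0,1,2,5} (int2 F {0,1,2,4} (int2 F {0,1,2,3}
      (P10 F (LX F ζ) (LTT F ζ) (LS F ζ) (LY F ζ) (LV F ζ) (U4 F ζ) (U1 F ζ) (U2 F ζ) (U3 F ζ)
        (ea F {0,1,2,3})))) =
    (-((ζ 1 - ζ 2) * (ζ 3 - ζ 4) * (ζ 2 - ζ 4) * (ζ 2 - ζ 5) ^ 2)) • PU F ζ := by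
  rw [← neg_neg (PU F ζ), ← PU_rot]
  have e1 := LX_L F ζ
  have e2 := LY_L F ζ
  have e3 := LS_L F ζ h24
  have e4 := LTT_L F ζ h24 h12 h34
  have e5 := LV_L F ζ h24 h12 h34
  have e6 := W_L F
  have e7 := U1_L F ζ
  have e8 := U2_L F ζ
  have e9 := U3_L F ζ
  have e10 := U4_L F ζ
  generalize ea F {0,1,2,3} = w at *
  simp only [P10_eq, int2, da_mul, db_mul, da_one, db_one, e1, e2, e3, e4, e5, e6, e7, e8, e9, e10,
    zero_smul, zero_sub, sub_zero, mul_zero, neg_zero, map_zero, map_one, mul_one, map_neg,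
    map_smul, mul_neg, neg_neg, smul_neg, neg_smul, mul_smul_comm, one_smul, smul_smul, sub_self]
  first | done | (match_scalars; field_simp)

theorem int_R :
    int2 F {2,3,4,5} (int2 F {1,3,4,5} (int2 F {0,3,4,5}
      (P10 F (U1 F ζ) (U2 F ζ) (RQ F ζ) (l1 F ζ 0 2 3 4 5) (U3 F ζ) (RR F ζ) (l1 F ζ 1 2 3 4 5)
        (l2 F ζ 1 2 3 4 5) (U4 F ζ) (eb F {0,3,4,5})))) =
    (-(ζ 4 - ζ 5) ^ 5) • PU F ζ := by
  have e1 := RQ_R F ζ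
  have e2 := RR_R F ζ
  have e3 := q1_R F ζ
  have e4 := r1_R F ζ
  have e5 := r2_R F ζ
  have e6 := W_R F
  have e7 := U1_R F ζ
  have e8 := U2_R F ζ
  have e9 := U3_R F ζ
  have e10 := U4_R F ζ
  generalize eb F {0,3,4,5} = w at *
  simp only [P10_eq, int2, da_mul, db_mul, da_one, db_one, e1, e2, e3, e4, e5, e6, e7, e8, e9, e10,
    zero_smul, zero_sub, sub_zero, mul_zero, neg_zero, map_zero, map_one, mul_one, map_neg,
    map_smul, mul_neg, neg_neg, smul_neg, neg_smul, mul_smul_comm, ← PU.eq_1, one_smul, smul_smul, sub_self]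
  first | done | (match_scalars; field_simp)

theorem int2_smul (t : Finset (Fin 6)) (c : F) (x : Lam F) : int2 F t (c • x) = c • int2 F t x := by
  simp only [int2, map_smul]

/-- Theorem 2 of the paper: the undeformed Grassmann-algebraic relation corresponding
to the Pachner move 3→3 (vertices 0-indexed: `1,…,6 ↦ 0,…,5`), with
`w₁₂₃ = ζ₂₃⁻¹ζ₃₄ a₁₂₃₄` and `w₄₅₆ = −b₁₄₅₆`. -/
theorem pachner_33_undeformed (hchar : (2 : F) ≠ 0) (hζ : Function.Injective ζ) :
    ((ζ 2 - ζ 3) * (ζ 2 - ζ 4) * (ζ 2 - ζ 5))⁻¹ •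
      int2 F {0,1,2,5} (int2 F {0,1,2,4} (int2 F {0,1,2,3}
        (W F ζ 0 1 2 3 4 * W F ζ 0 1 2 3 5 * W F ζ 0 1 2 4 5 *
          (((ζ 1 - ζ 2)⁻¹ * (ζ 2 - ζ 3)) • av F {0,1,2,3}))))
    = ((ζ 4 - ζ 5) * (ζ 4 - ζ 5) * (ζ 4 - ζ 5))⁻¹ •
        int2 F {2,3,4,5} (int2 F {1,3,4,5} (int2 F {0,3,4,5}
          (W F ζ 0 1 3 4 5 * W F ζ 0 2 3 4 5 * W F ζ 1 2 3 4 5 * (-bv F {0,3,4,5})))) := by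
  have hne : ∀ i j : Fin 6, i ≠ j → ζ i - ζ j ≠ 0 := fun i j hij =>
    sub_ne_zero.mpr (fun h => hij (hζ h))
  have h12 := hne 1 2 (by decide)
  have h23 := hne 2 3 (by decide)
  have h24 := hne 2 4 (by decide)
  have h25 := hne 2 5 (by decide)
  have h34 := hne 3 4 (by decide)
  have h35 := hne 3 5 (by decide)
  have h45 := hne 4 5 (by decide)
  have hL : W F ζ 0 1 2 3 4 * W F ζ 0 1 2 3 5 * W F ζ 0 1 2 4 5 *
          (((ζ 1 - ζ 2)⁻¹ * (ζ 2 - ζ 3)) • av F {0,1,2,3}) =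
      ((ζ 3 - ζ 4)⁻¹ * (ζ 3 - ζ 5)⁻¹ * (ζ 4 - ζ 5)⁻¹ * ((ζ 1 - ζ 2)⁻¹ * (ζ 2 - ζ 3))) •
      P10 F (l1 F ζ 0 1 2 3 4) (l2 F ζ 0 1 2 3 4) (l3 F ζ 0 1 2 3 4)
        (l1 F ζ 0 1 2 3 5) (l2 F ζ 0 1 2 3 5) (l3 F ζ 0 1 2 3 5)
        (l1 F ζ 0 1 2 4 5) (l2 F ζ 0 1 2 4 5) (l3 F ζ 0 1 2 4 5) (ea F {0,1,2,3}) := by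
    simp only [W, v1_eq, v2_eq, v3_eq, av, P10_eq, smul_mul_assoc, mul_smul_comm, smul_smul,
      mul_assoc]
    congr 1
    ring
  have hR : W F ζ 0 1 3 4 5 * W F ζ 0 2 3 4 5 * W F ζ 1 2 3 4 5 * (-bv F {0,3,4,5}) =
      (-((ζ 4 - ζ 5)⁻¹ * (ζ 4 - ζ 5)⁻¹ * (ζ 4 - ζ 5)⁻¹)) •
      P10 F (l1 F ζ 0 1 3 4 5) (l2 F ζ 0 1 3 4 5) (l3 F ζ 0 1 3 4 5)
        (l1 F ζ 0 2 3 4 5) (l2 F ζ 0 2 3 4 5) (l3 F ζ 0 2 3 4 5)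
        (l1 F ζ 1 2 3 4 5) (l2 F ζ 1 2 3 4 5) (l3 F ζ 1 2 3 4 5) (eb F {0,3,4,5}) := by
    simp only [W, v1_eq, v2_eq, v3_eq, bv, P10_eq, smul_mul_assoc, mul_smul_comm, smul_smul,
      mul_assoc, mul_neg, neg_smul, smul_neg]
  have rL := lhs_red (ExteriorAlgebra.ιMulti F 10)
    (l1 F ζ 0 1 2 3 4) (l2 F ζ 0 1 2 3 4) (l3 F ζ 0 1 2 3 4)
    (l1 F ζ 0 1 2 3 5) (l2 F ζ 0 1 2 3 5) (l3 F ζ 0 1 2 3 5)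
    (l1 F ζ 0 1 2 4 5) (l2 F ζ 0 1 2 4 5) (l3 F ζ 0 1 2 4 5) (ea F {0,1,2,3})
    (U1 F ζ) (U2 F ζ) (U3 F ζ) (U4 F ζ) (LX F ζ) (LY F ζ) (LS F ζ) (LTT F ζ) (LV F ζ)
    (ζ 2 - ζ 3) (ζ 2 - ζ 3) (-(ζ 0 - ζ 3)) (-((ζ 0 - ζ 4) / (ζ 2 - ζ 4)))
    (-((ζ 1 - ζ 4) / (ζ 2 - ζ 4))) ((ζ 3 - ζ 5) * (ζ 2 - ζ 4) / ((ζ 2 - ζ 5) * (ζ 3 - ζ 4)))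
    (-(ζ 0 - ζ 3)) (-((ζ 0 - ζ 5) / (ζ 2 - ζ 5))) (-((ζ 1 - ζ 5) / (ζ 2 - ζ 5)))
    (-((ζ 2 - ζ 3) * (ζ 2 - ζ 4) / ((ζ 1 - ζ 2) * (ζ 3 - ζ 4))))
    (-((ζ 2 - ζ 3) * (ζ 2 - ζ 4) / ((ζ 1 - ζ 2) * (ζ 3 - ζ 4))))
    ((ζ 3 - ζ 5) / (ζ 2 - ζ 5))
    (by rw [u1_eq]; module) (by rw [u2_eq]; module) (by rw [u3_eq]; module)
    (by rw [LX]; module) (by rw [LY]; module) (by rw [LS]; module)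
    (by
      simp only [U4, LS, LX, LY, l1, l2, l3]
      match_scalars <;> field_simp <;> ring)
    (by rw [LTT]; module) (by rw [LV]; module)
  have rR := rhs_red (ExteriorAlgebra.ιMulti F 10)
    (l1 F ζ 0 1 3 4 5) (l2 F ζ 0 1 3 4 5) (l3 F ζ 0 1 3 4 5)
    (l1 F ζ 0 2 3 4 5) (l2 F ζ 0 2 3 4 5) (l3 F ζ 0 2 3 4 5)
    (l1 F ζ 1 2 3 4 5) (l2 F ζ 1 2 3 4 5) (l3 F ζ 1 2 3 4 5) (eb F {0,3,4,5})
    (U1 F ζ) (U2 F ζ) (U3 F ζ) (U4 F ζ) (RQ F ζ) (RR F ζ) (-(ζ 4 - ζ 5))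
    (by rw [U1]; module) (by rw [U2]; module) (by rw [U3]; module) (by rw [U4]; module)
    (by rw [RQ]; module) (by rw [RR]; module)
  rw [← P10, ← P10] at rL rR
  rw [hL, hR, rL, rR]
  simp only [int2_smul, int_L F ζ h24 h12 h34, int_R, smul_smul]
  congr 1
  field_simp

end
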